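/- arXiv:2512.13959 — 4 statements merged into one kernel-verified Lean document; each statement's English description precedes it below -/
import Mathlib

section
/- For every x ∈ Ū, every z ≥ 0 and every v ∈ ℝ³, if y = g(x,|v|) v + R*(x) z^λ (k⃗ × v), then (i) |v| ≤ W₀(x) |y|^{1−a}, and (ii) v·y ≥ W₁(x) |y|^{2−a} / (χ*² (1+z)^{2λ}) − W₂(x). Equivalently, for each x ∈ Ū and z ≥ 0 the map v ↦ g(x,|v|)v + R*(x)z^λ (k⃗×v) has the property that its (pointwise) inverse X(x,z,·) satisfies |X(x,z,y)| ≤ W₀(x)|y|^{1−a} and X(x,z,y)·y ≥ W₁(x)|y|^{2−a}/(χ*²(1+z)^{2λ}) − W₂(x) for all y in its range. -/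
open scoped RealInnerProductSpace

/-- Cross product on `EuclideanSpace ℝ (Fin 3)`. -/
noncomputable def cross3 (k v : EuclideanSpace ℝ (Fin 3)) : EuclideanSpace ℝ (Fin 3) :=
  (EuclideanSpace.equiv (Fin 3) ℝ).symm
    (crossProduct ((EuclideanSpace.equiv (Fin 3) ℝ) k) ((EuclideanSpace.equiv (Fin 3) ℝ) v))

theorem norm_sq_cross3 (k v : EuclideanSpace ℝ (Fin 3)) :
    ‖cross3 k v‖ ^ 2 = ‖k‖ ^ 2 * ‖v‖ ^ 2 - ⟪k, v⟫ ^ 2 := by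
  simp only [EuclideanSpace.norm_sq_eq, PiLp.inner_apply, Fin.sum_univ_three, cross3,
    cross_apply, Real.norm_eq_abs, sq_abs]
  simp
  ring

theorem norm_cross3_le (k v : EuclideanSpace ℝ (Fin 3)) : ‖cross3 k v‖ ≤ ‖k‖ * ‖v‖ := by
  refine abs_le_of_sq_le_sq' ?_ (by positivity) |>.2
  rw [norm_sq_cross3, mul_pow]
  nlinarith [sq_nonneg (⟪k, v⟫ : ℝ)]

theorem inner_cross3_right (k v : EuclideanSpace ℝ (Fin 3)) : ⟪v, cross3 k v⟫ = 0 := by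
  simp only [PiLp.inner_apply, Fin.sum_univ_three, cross3, cross_apply]
  simp
  ring

section GeneralizedPolynomial

variable {N : ℕ} {e b : ℕ → ℝ} {s : ℝ}

theorem generalizedPolynomial_le (he0 : ∀ i ≤ N, 0 ≤ e i) (heN : ∀ i ≤ N, e i ≤ e N)
    (hb : ∀ i ≤ N, 0 ≤ b i) (hs : 0 ≤ s) :
    ∑ i ∈ Finset.range (N + 1), b i * s ^ e i
      ≤ (∑ i ∈ Finset.range (N + 1), b i) * (1 + s) ^ e N := by
  rw [Finset.sum_mul]
  refine Finset.sum_le_sum fun i hi => ?_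
  have hi' : i ≤ N := by simpa [Nat.lt_succ_iff] using hi
  refine mul_le_mul_of_nonneg_left ?_ (hb i hi')
  exact (Real.rpow_le_rpow hs (by linarith) (he0 i hi')).trans
    (Real.rpow_le_rpow_of_exponent_le (by linarith) (heN i hi'))

theorem endpoint_terms_le_generalizedPolynomial (hN : 1 ≤ N) (he : e 0 = 0)
    (hb : ∀ i ≤ N, 0 ≤ b i) (hs : 0 ≤ s) :
    b 0 + b N * s ^ e N ≤ ∑ i ∈ Finset.range (N + 1), b i * s ^ e i := by
  have h : ∑ i ∈ {0, N}, b i * s ^ e i ≤ ∑ i ∈ Finset.range (N + 1), b i * s ^ e i := by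
    refine Finset.sum_le_sum_of_subset_of_nonneg (fun i hi => ?_) fun i hi _ => ?_
    · simp only [Finset.mem_insert, Finset.mem_singleton] at hi
      simp only [Finset.mem_range]
      omega
    · exact mul_nonneg (hb i (by simpa [Nat.lt_succ_iff] using hi)) (Real.rpow_nonneg hs _)
  rwa [Finset.sum_pair (by omega), he, Real.rpow_zero, mul_one] at h

end GeneralizedPolynomial

theorem one_add_rpow_le {s α : ℝ} (hs : 0 ≤ s) (hα : 0 ≤ α) :
    (1 + s) ^ α ≤ 2 ^ α * (1 + s ^ α) := by
  have hsα : 0 ≤ s ^ α := Real.rpow_nonneg hs _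
  have h2 : (0 : ℝ) < 2 ^ α := by positivity
  rcases le_total s 1 with h | h
  · have := Real.rpow_le_rpow (by linarith) (show 1 + s ≤ 2 by linarith) hα
    nlinarith
  · have := Real.rpow_le_rpow (by linarith) (show 1 + s ≤ 2 * s by linarith) hα
    rw [Real.mul_rpow (by norm_num) hs] at this
    nlinarith

/-- If `s` is controlled by `Y` through a lower growth bound, then `(1 + s) ^ α` is of order at
most `Y ^ a` with `a = α / (1 + α)`. -/
theorem one_add_rpow_le_of_growth {s Y c α a : ℝ} (hs : 0 ≤ s) (hα : 0 < α) (hc : 0 < c)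
    (hY : 1 ≤ Y) (ha : a = α / (1 + α)) (hc2 : c * 2 ^ α ≤ 1)
    (hlow : c * (1 + s) ^ α * s ≤ Y) : (1 + s) ^ α ≤ (2 * Y / c) ^ a := by
  have h1 : (1 + s) ^ (1 + α) ≤ 2 * Y / c := by
    rw [le_div_iff₀ hc, Real.rpow_add (by linarith), Real.rpow_one]
    have hP : 0 ≤ (1 + s) ^ α := by positivity
    rcases le_total s 1 with h | h
    · have h2 := Real.rpow_le_rpow (by linarith) (show 1 + s ≤ 2 by linarith) hα.le
      have h3 : (1 + s) ^ α * c ≤ 1 := by nlinarith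
      nlinarith [mul_nonneg hP hc.le]
    · nlinarith [mul_nonneg (mul_nonneg hP hc.le) (sub_nonneg.2 h)]
  have h2 := Real.rpow_le_rpow (by positivity) h1 (show 0 ≤ a by rw [ha]; positivity)
  rwa [← Real.rpow_mul (by linarith), ha, mul_div_cancel₀ _ (by positivity), ← ha] at h2

/-- Coercivity estimate behind the lower bound on the pairing `g * s ^ 2`. -/
theorem coercive_lower_bound {s Y c M X G α a : ℝ} (hs : 0 ≤ s) (hα : 0 < α) (hc : 0 < c)
    (hY : 0 ≤ Y) (hX : 0 < X) (hXM : X ≤ M) (ha : a = α / (1 + α)) (hc2 : c * 2 ^ α ≤ 1)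
    (hG : c * (1 + s) ^ α ≤ G) (hlow : G * s ≤ Y) (hup : Y ≤ M * (1 + s) ^ α * s) :
    2 ^ (-a) * c ^ (1 + a) / M ^ 2 * Y ^ (2 - a) - 2 ^ (-a) * c ^ (1 + a) / X ^ 2
      ≤ G * s ^ 2 := by
  have hP : 0 < (1 + s) ^ α := by positivity
  have hM : 0 < M := hX.trans_le hXM
  have hG0 : 0 ≤ G := by nlinarith [mul_pos hc hP]
  have hK : 0 < (2 : ℝ) ^ (-a) * c ^ (1 + a) := by positivity
  have ha1 : a ≤ 1 := by rw [ha, div_le_one (by positivity)]; linarith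
  rcases le_total Y 1 with h | h
  · have h1 : Y ^ (2 - a) ≤ 1 := Real.rpow_le_one hY h (by linarith)
    have h2 : 2 ^ (-a) * c ^ (1 + a) / M ^ 2 ≤ 2 ^ (-a) * c ^ (1 + a) / X ^ 2 := by gcongr
    have h3 : 2 ^ (-a) * c ^ (1 + a) / M ^ 2 * Y ^ (2 - a) ≤ 2 ^ (-a) * c ^ (1 + a) / M ^ 2 :=
      mul_le_of_le_one_right (by positivity) h1
    nlinarith [mul_nonneg hG0 (sq_nonneg s)]
  · have hY0 : 0 < Y := by linarith
    have h1 := one_add_rpow_le_of_growth hs hα hc h ha hc2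
      ((mul_le_mul_of_nonneg_right hG hs).trans hlow)
    have h2 : 2 ^ (-a) * c ^ (1 + a) / M ^ 2 * Y ^ (2 - a)
        = c * Y ^ 2 / (M ^ 2 * (2 * Y / c) ^ a) := by
      rw [Real.div_rpow (by positivity) hc.le, Real.mul_rpow (by norm_num) hY,
        Real.rpow_neg (by norm_num), Real.rpow_add hc, Real.rpow_one, Real.rpow_sub hY0,
        Real.rpow_two]
      field_simp
    have h3 : c * Y ^ 2 / (M ^ 2 * (2 * Y / c) ^ a) ≤ c * Y ^ 2 / (M ^ 2 * (1 + s) ^ α) := by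
      gcongr
    have h4 : c * Y ^ 2 / (M ^ 2 * (1 + s) ^ α) ≤ c * (1 + s) ^ α * s ^ 2 := by
      rw [div_le_iff₀ (by positivity)]
      calc c * Y ^ 2 ≤ c * (M * (1 + s) ^ α * s) ^ 2 := by gcongr
        _ = c * (1 + s) ^ α * s ^ 2 * (M ^ 2 * (1 + s) ^ α) := by ring
    have h5 : c * (1 + s) ^ α * s ^ 2 ≤ G * s ^ 2 := by gcongr
    have h6 : 0 < 2 ^ (-a) * c ^ (1 + a) / X ^ 2 := by positivity
    rw [h2]
    linarith

/-- Lemma 2.2 (`Xlem`): bounds for the inverse of the rotating Forchheimer map. -/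
theorem stmt_0
    (U : Set (EuclideanSpace ℝ (Fin 3)))
    (hUo : IsOpen U) (hUne : U.Nonempty) (hUb : Bornology.IsBounded U)
    (N : ℕ) (hN : 1 ≤ N)
    (abar : ℕ → ℝ) (habar0 : abar 0 = 0)
    (habarmono : ∀ i, i < N → abar i < abar (i + 1))
    (A : ℕ → EuclideanSpace ℝ (Fin 3) → ℝ)
    (hA0 : ∀ x ∈ closure U, 0 < A 0 x)
    (hAN : ∀ x ∈ closure U, 0 < A N x)
    (hAnn : ∀ i, 1 ≤ i → i < N → ∀ x ∈ closure U, 0 ≤ A i x)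
    (g : EuclideanSpace ℝ (Fin 3) → ℝ → ℝ)
    (hg : ∀ x s, g x s = ∑ i ∈ Finset.range (N + 1), A i x * s ^ abar i)
    (a : ℝ) (ha : a = abar N / (1 + abar N))
    (k : EuclideanSpace ℝ (Fin 3)) (hk : ‖k‖ = 1)
    (lam cbar Ω : ℝ) (hlam0 : 0 < lam) (hlam1 : lam ≤ 1) (hcbar : 0 < cbar) (hΩ : 0 ≤ Ω)
    (χs : ℝ) (hχs : χs = 1 + Ω)
    (φ : EuclideanSpace ℝ (Fin 3) → ℝ) (hφ : ∀ x ∈ closure U, 0 < φ x)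
    (Rs : EuclideanSpace ℝ (Fin 3) → ℝ) (hRs : ∀ x, Rs x = 2 * cbar * Ω / φ x)
    (χ₀ : EuclideanSpace ℝ (Fin 3) → ℝ)
    (hχ₀ : ∀ x, χ₀ x = ∑ i ∈ Finset.range (N + 1), A i x)
    (c₄ : EuclideanSpace ℝ (Fin 3) → ℝ)
    (hc₄ : ∀ x, c₄ x = (min 1 (min (A 0 x) (A N x)) / (2:ℝ) ^ abar N) ^ (1 + a))
    (W₀ W₁ W₂ : EuclideanSpace ℝ (Fin 3) → ℝ)
    (hW₀ : ∀ x, W₀ x = A N x ^ (a - 1))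
    (hW₁ : ∀ x, W₁ x = (2:ℝ) ^ (-a) * c₄ x / ((1 + 2 * cbar) ^ 2 * (χ₀ x + (φ x)⁻¹) ^ 2))
    (hW₂ : ∀ x, W₂ x = (2:ℝ) ^ (-a) * c₄ x / (χ₀ x) ^ 2) :
    ∀ x ∈ closure U, ∀ z : ℝ, 0 ≤ z → ∀ v y : EuclideanSpace ℝ (Fin 3),
      y = g x ‖v‖ • v + (Rs x * z ^ lam) • cross3 k v →
      ‖v‖ ≤ W₀ x * ‖y‖ ^ (1 - a) ∧
        W₁ x * ‖y‖ ^ (2 - a) / (χs ^ 2 * (1 + z) ^ (2 * lam)) - W₂ x ≤ ⟪v, y⟫ := by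
  intro x hx z hz v y hy
  have hb : ∀ i ≤ N, 0 ≤ A i x := by
    intro i hi
    rcases Nat.eq_zero_or_pos i with rfl | h0
    · exact (hA0 x hx).le
    · rcases hi.lt_or_eq with h | rfl
      · exact hAnn i h0 h x hx
      · exact (hAN x hx).le
  have hmono : ∀ n ≤ N, ∀ i ≤ n, abar i ≤ abar n := by
    intro n
    induction n with
    | zero => intro _ i hi; rw [Nat.le_zero.1 hi]
    | succ n ih =>
      intro hn i hi
      rcases hi.lt_or_eq with h | rfl
      · exact (ih (by omega) i (by omega)).trans (habarmono n (by omega)).le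
      · exact le_rfl
  have he0 : ∀ i ≤ N, 0 ≤ abar i := fun i hi => habar0 ▸ hmono i hi 0 (Nat.zero_le _)
  have hα : 0 < abar N := by
    have := habarmono 0 (by omega)
    rw [habar0] at this
    exact this.trans_le (hmono N le_rfl _ (by omega))
  have hs : 0 ≤ ‖v‖ := norm_nonneg v
  have hgl := endpoint_terms_le_generalizedPolynomial (b := fun i => A i x) hN habar0 hb hs
  have hgu := generalizedPolynomial_le (b := fun i => A i x) he0 (hmono N le_rfl) hb hs
  simp only [← hg, ← hχ₀] at hgl hgu
  have hA0x := hA0 x hx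
  have hANx := hAN x hx
  have hφx := hφ x hx
  have hsα : 0 ≤ ‖v‖ ^ abar N := by positivity
  have hg0 : 0 < g x ‖v‖ := by nlinarith
  have hχ : 0 < χ₀ x := by
    have hP : 0 < (1 + ‖v‖) ^ abar N := by positivity
    exact pos_of_mul_pos_left (hg0.trans_le hgu) hP.le
  have hinner : ⟪v, y⟫ = g x ‖v‖ * ‖v‖ ^ 2 := by
    rw [hy, inner_add_right, inner_smul_right, inner_smul_right, inner_cross3_right,
      real_inner_self_eq_norm_sq]
    ring
  have hlow : g x ‖v‖ * ‖v‖ ≤ ‖y‖ := by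
    rcases hs.eq_or_lt with h | h
    · rw [← h]; simp
    · have := real_inner_le_norm v y
      rw [hinner] at this
      nlinarith
  have hR : 0 ≤ Rs x * z ^ lam := by rw [hRs]; positivity
  have hup : ‖y‖ ≤ (g x ‖v‖ + Rs x * z ^ lam) * ‖v‖ := by
    have hc := norm_cross3_le k v
    rw [hk, one_mul] at hc
    calc ‖y‖ ≤ ‖g x ‖v‖ • v‖ + ‖(Rs x * z ^ lam) • cross3 k v‖ := by
          rw [hy]; exact norm_add_le _ _
      _ = g x ‖v‖ * ‖v‖ + Rs x * z ^ lam * ‖cross3 k v‖ := by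
          rw [norm_smul, norm_smul, Real.norm_of_nonneg hg0.le, Real.norm_of_nonneg hR]
      _ ≤ _ := by rw [add_mul]; gcongr
  constructor
  · have h1 : A N x * ‖v‖ ^ (1 + abar N) ≤ ‖y‖ := by
      rw [Real.rpow_add_of_nonneg hs zero_le_one hα.le, Real.rpow_one]
      nlinarith
    have ha1 : 1 - a = (1 + abar N)⁻¹ := by rw [ha]; field_simp; ring
    have h2 := Real.rpow_le_rpow (by positivity) h1 (show 0 ≤ 1 - a by rw [ha1]; positivity)
    rw [Real.mul_rpow hANx.le (by positivity), ← Real.rpow_mul hs, ha1,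
      mul_inv_cancel₀ (by positivity), Real.rpow_one, ← ha1] at h2
    calc ‖v‖ = A N x ^ (a - 1) * (A N x ^ (1 - a) * ‖v‖) := by
          rw [← mul_assoc, ← Real.rpow_add hANx]; simp
      _ ≤ W₀ x * ‖y‖ ^ (1 - a) := by rw [hW₀]; gcongr
  · set m := min 1 (min (A 0 x) (A N x)) with hm
    have hm0 : 0 < m := lt_min one_pos (lt_min hA0x hANx)
    have hm1 : m ≤ 1 := min_le_left _ _
    have hmA0 : m ≤ A 0 x := (min_le_right _ _).trans (min_le_left _ _)
    have hmAN : m ≤ A N x := (min_le_right _ _).trans (min_le_right _ _)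
    have h2α : (0 : ℝ) < 2 ^ abar N := by positivity
    have hcg : m / 2 ^ abar N * (1 + ‖v‖) ^ abar N ≤ g x ‖v‖ := by
      calc m / 2 ^ abar N * (1 + ‖v‖) ^ abar N
          ≤ m / 2 ^ abar N * (2 ^ abar N * (1 + ‖v‖ ^ abar N)) := by
            gcongr; exact one_add_rpow_le hs hα.le
        _ = m + m * ‖v‖ ^ abar N := by field_simp
        _ ≤ A 0 x + A N x * ‖v‖ ^ abar N := by gcongr
        _ ≤ _ := hgl
    have hZ1 : 1 ≤ (1 + z) ^ lam := Real.one_le_rpow (by linarith) hlam0.le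
    have hP1 : 1 ≤ (1 + ‖v‖) ^ abar N := Real.one_le_rpow (by linarith) hα.le
    have hzZ : z ^ lam ≤ (1 + z) ^ lam := Real.rpow_le_rpow hz (by linarith) hlam0.le
    have hφi : 0 < (φ x)⁻¹ := by positivity
    have hfac : 1 ≤ (1 + 2 * cbar) * (1 + Ω) := by nlinarith [mul_nonneg hcbar.le hΩ]
    have hfac' : 2 * cbar * Ω ≤ (1 + 2 * cbar) * (1 + Ω) := by nlinarith
    have hXM : χ₀ x ≤ (1 + 2 * cbar) * (χ₀ x + (φ x)⁻¹) * (1 + Ω) * (1 + z) ^ lam := by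
      calc χ₀ x ≤ 1 * (χ₀ x + (φ x)⁻¹) * 1 := by linarith
        _ ≤ ((1 + 2 * cbar) * (1 + Ω)) * (χ₀ x + (φ x)⁻¹) * (1 + z) ^ lam := by gcongr
        _ = _ := by ring
    have hyM : ‖y‖ ≤ ((1 + 2 * cbar) * (χ₀ x + (φ x)⁻¹) * (1 + Ω) * (1 + z) ^ lam)
        * (1 + ‖v‖) ^ abar N * ‖v‖ := by
      refine hup.trans (mul_le_mul_of_nonneg_right ?_ hs)
      have h1 : χ₀ x * (1 + ‖v‖) ^ abar N
          ≤ ((1 + 2 * cbar) * (1 + Ω)) * χ₀ x * (1 + z) ^ lam * (1 + ‖v‖) ^ abar N := by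
        calc χ₀ x * (1 + ‖v‖) ^ abar N = 1 * χ₀ x * 1 * (1 + ‖v‖) ^ abar N := by ring
          _ ≤ _ := by gcongr
      have h2 : Rs x * z ^ lam
          ≤ ((1 + 2 * cbar) * (1 + Ω)) * (φ x)⁻¹ * (1 + z) ^ lam * (1 + ‖v‖) ^ abar N := by
        calc Rs x * z ^ lam = (2 * cbar * Ω) * (φ x)⁻¹ * z ^ lam * 1 := by
              rw [hRs, div_eq_mul_inv]; ring
          _ ≤ _ := by gcongr
      linarith
    have key := coercive_lower_bound hs hα (div_pos hm0 h2α) (norm_nonneg y) hχ hXM ha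
      (by rwa [div_mul_cancel₀ _ h2α.ne']) hcg hlow hyM
    rw [hinner, hW₁, hW₂, hc₄, ← hm, hχs, mul_comm 2 lam, Real.rpow_mul (by linarith), Real.rpow_two]
    convert key using 2
    field_simp
end

section
/- Let T > 0, q > 0 and K > 0 be real numbers. Let V : [0,T) → ℝ be differentiable with V(t) ≥ 1 for all t, and let M : (0,T) → ℝ be integrable with M(t) ≥ 1 for all t. Assume V′(t) ≤ K (V(t)^{1+q} + M(t)) for all t ∈ (0,T), and assume ∫₀^T M(τ) dτ ≤ V(0)^{−q}/(2qK). Then for every t ∈ [0,T) one has 1 − 2qK V(0)^{q} ∫₀^t M(τ) dτ > 0 and V(t) ≤ V(0) · (1 − 2qK V(0)^{q} ∫₀^t M(τ) dτ)^{−1/q}. -/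
open MeasureTheory

/-- The Bernoulli/Gronwall-type differential-inequality argument in the proof of
Theorem 4.3(i). -/
theorem stmt_8 (T q K : ℝ) (hT : 0 < T) (hq : 0 < q) (hK : 0 < K)
    (V V' M : ℝ → ℝ)
    (hV : ∀ t ∈ Set.Ico (0:ℝ) T, HasDerivWithinAt V (V' t) (Set.Ico (0:ℝ) T) t)
    (hV1 : ∀ t ∈ Set.Ico (0:ℝ) T, 1 ≤ V t)
    (hMint : IntegrableOn M (Set.Ioo (0:ℝ) T))
    (hM1 : ∀ t ∈ Set.Ioo (0:ℝ) T, 1 ≤ M t)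
    (hV' : ∀ t ∈ Set.Ioo (0:ℝ) T, V' t ≤ K * (V t ^ (1 + q) + M t))
    (hsmall : (∫ τ in (0:ℝ)..T, M τ) ≤ V 0 ^ (-q) / (2 * q * K)) :
    ∀ t ∈ Set.Ico (0:ℝ) T,
      0 < 1 - 2 * q * K * V 0 ^ q * (∫ τ in (0:ℝ)..t, M τ) ∧
        V t ≤ V 0 * (1 - 2 * q * K * V 0 ^ q * (∫ τ in (0:ℝ)..t, M τ)) ^ (-(1 / q)) := by
  intro t ht
  obtain ⟨ht0, htT⟩ := ht
  have hpos : ∀ s ∈ Set.Ico (0:ℝ) T, 0 < V s := fun s hs => one_pos.trans_le (hV1 s hs)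
  have hV0 : 0 < V 0 := hpos 0 ⟨le_rfl, hT⟩
  have hVt : 0 < V t := hpos t ⟨ht0, htT⟩
  have hMIcc : IntegrableOn M (Set.Icc 0 T) := by
    rwa [integrableOn_Icc_iff_integrableOn_Ioo]
  have hM0t : IntegrableOn M (Set.Icc 0 t) :=
    hMIcc.mono_set (Set.Icc_subset_Icc_right htT.le)
  have hMtT : IntegrableOn M (Set.Icc t T) :=
    hMIcc.mono_set (Set.Icc_subset_Icc_left ht0)
  have hi0t : IntervalIntegrable M volume 0 t :=
    (intervalIntegrable_iff_integrableOn_Icc_of_le ht0).2 hM0t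
  have hitT : IntervalIntegrable M volume t T :=
    (intervalIntegrable_iff_integrableOn_Icc_of_le htT.le).2 hMtT
  have htail : 0 < ∫ τ in t..T, M τ :=
    intervalIntegral.intervalIntegral_pos_of_pos_on hitT
      (fun x hx => one_pos.trans_le (hM1 x ⟨ht0.trans_lt hx.1, hx.2⟩)) htT
  have hsplit := intervalIntegral.integral_add_adjacent_intervals hi0t hitT
  have hmul : V 0 ^ q * V 0 ^ (-q) = 1 := by
    rw [← Real.rpow_add hV0, add_neg_cancel, Real.rpow_zero]
  have hVq : 0 < V 0 ^ q := Real.rpow_pos_of_pos hV0 q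
  have hlt : 2 * q * K * (∫ τ in (0:ℝ)..t, M τ) < V 0 ^ (-q) := by
    have h : (∫ τ in (0:ℝ)..t, M τ) < V 0 ^ (-q) / (2 * q * K) := by linarith
    rw [lt_div_iff₀ (by positivity)] at h
    linarith
  have hD : 0 < 1 - 2 * q * K * V 0 ^ q * (∫ τ in (0:ℝ)..t, M τ) := by
    have := mul_lt_mul_of_pos_left hlt hVq
    linarith
  refine ⟨hD, ?_⟩
  have hderiv : ∀ x ∈ Set.Ioo 0 t, HasDerivWithinAt (fun s => -V s ^ (-q))
      (-(V' x * (-q) * V x ^ (-q - 1))) (Set.Ioi x) x := by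
    intro x hx
    have hxT : x ∈ Set.Ico 0 T := ⟨hx.1.le, hx.2.trans htT⟩
    have hVx : HasDerivAt V (V' x) x :=
      (hV x hxT).hasDerivAt (Ico_mem_nhds hx.1 (hx.2.trans htT))
    exact ((hVx.rpow_const (Or.inl (hpos x hxT).ne')).neg).hasDerivWithinAt
  have hcont : ContinuousOn (fun s => -V s ^ (-q)) (Set.Icc 0 t) := by
    have hsub : Set.Icc 0 t ⊆ Set.Ico 0 T := fun x hx => ⟨hx.1, hx.2.trans_lt htT⟩
    have hVc : ContinuousOn V (Set.Icc 0 t) := fun x hx =>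
      ((hV x (hsub hx)).continuousWithinAt).mono hsub
    exact (hVc.rpow_const fun x hx => Or.inl (hpos x (hsub hx)).ne').neg
  have hbound : ∀ x ∈ Set.Ioo 0 t,
      -(V' x * (-q) * V x ^ (-q - 1)) ≤ 2 * q * K * M x := by
    intro x hx
    have hxT : x ∈ Set.Ioo 0 T := ⟨hx.1, hx.2.trans htT⟩
    have hx1 := hV1 x (Set.Ioo_subset_Ico_self hxT)
    have hx0 : 0 < V x := by linarith
    have hM := hM1 x hxT
    have hP : 0 < V x ^ (-q - 1) := Real.rpow_pos_of_pos hx0 _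
    have hP1 : V x ^ (-q - 1) ≤ 1 := Real.rpow_le_one_of_one_le_of_nonpos hx1 (by linarith)
    have hPmul : V x ^ (1 + q) * V x ^ (-q - 1) = 1 := by
      rw [← Real.rpow_add hx0, show 1 + q + (-q - 1) = 0 by ring, Real.rpow_zero]
    have hPM : V x ^ (-q - 1) * M x ≤ M x := mul_le_of_le_one_left (by linarith) hP1
    calc -(V' x * (-q) * V x ^ (-q - 1)) = q * V x ^ (-q - 1) * V' x := by ring
      _ ≤ q * V x ^ (-q - 1) * (K * (V x ^ (1 + q) + M x)) := by
        gcongr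
        exact hV' x hxT
      _ = q * K * (V x ^ (1 + q) * V x ^ (-q - 1) + V x ^ (-q - 1) * M x) := by ring
      _ ≤ q * K * (M x + M x) := by
        gcongr
        exact hPmul.trans_le hM
      _ = 2 * q * K * M x := by ring
  have hmain := intervalIntegral.sub_le_integral_of_hasDeriv_right_of_le ht0 hcont hderiv
    (hM0t.const_mul (2 * q * K)) hbound
  rw [intervalIntegral.integral_const_mul] at hmain
  have hle : V 0 ^ (-q) * (1 - 2 * q * K * V 0 ^ q * (∫ τ in (0:ℝ)..t, M τ)) ≤ V t ^ (-q) := by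
    have : V 0 ^ (-q) * (1 - 2 * q * K * V 0 ^ q * (∫ τ in (0:ℝ)..t, M τ))
        = V 0 ^ (-q) - 2 * q * K * (∫ τ in (0:ℝ)..t, M τ) := by
      linear_combination (-(2 * q * K * ∫ τ in (0:ℝ)..t, M τ)) * hmul
    linarith
  have hroot : ∀ v : ℝ, 0 < v → (v ^ (-q)) ^ (-(1 / q)) = v := fun v hv => by
    rw [← Real.rpow_mul hv.le, neg_mul_neg, mul_one_div_cancel hq.ne', Real.rpow_one]
  have hV0q : 0 < V 0 ^ (-q) := Real.rpow_pos_of_pos hV0 _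
  have hfin := Real.rpow_le_rpow_of_nonpos (mul_pos hV0q hD) hle
    (neg_nonpos.2 (one_div_pos.2 hq).le)
  rwa [Real.mul_rpow hV0q.le hD.le, hroot _ hVt, hroot _ hV0] at hfin
end

section
/- Let α₃ > 0 be such that m₄ := ((α₃−1)(2−a) − (α−λ−1))/(1−a) > 0, and set α₅ = p₅ m₄ and α₆ = p₅ (m₄ + 2λ/(1−a)). Define A₀ = ∫₀^T∫_U (u^{α−λ−1}/(1+u)^{2λ}) |∇u|^{2−a} W₁ ξ² dx dt, F₅ = (∫₀^T∫_U W₁^{−q₅/(1−a)} φ^{−q₅/p₅} ξ² dx dt)^{1/q₅}, and E(β) = ∫₀^T∫_U φ u^{β} ξ dx dt for β > 0. Then ∫₀^T∫_U u^{α₃−1} |∇u| ξ² dx dt ≤ 2^{2λ/(2−a)} A₀^{1/(2−a)} F₅^{(1−a)/(2−a)} ( E(α₅)^{1/p₅} + E(α₆)^{1/p₅} )^{(1−a)/(2−a)}. -/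
open MeasureTheory
open scoped ENNReal

/-- Hölder's inequality for a function dominated by a geometric mean of two functions. -/
theorem lintegral_ofReal_le_of_le_rpow_mul_rpow {X : Type*} [MeasurableSpace X] {μ : Measure X}
    {p q : ℝ} (hpq : p.HolderConjugate q) {f g h : X → ℝ}
    (hf : AEMeasurable f μ) (hg : AEMeasurable g μ)
    (hf0 : ∀ᵐ x ∂μ, 0 ≤ f x) (hg0 : ∀ᵐ x ∂μ, 0 ≤ g x)
    (hh : ∀ᵐ x ∂μ, h x ≤ f x ^ (1 / p) * g x ^ (1 / q)) :
    ∫⁻ x, ENNReal.ofReal (h x) ∂μ ≤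
      (∫⁻ x, ENNReal.ofReal (f x) ∂μ) ^ (1 / p) * (∫⁻ x, ENNReal.ofReal (g x) ∂μ) ^ (1 / q) := by
  have hp := hpq.pos
  have hq := hpq.symm.pos
  calc ∫⁻ x, ENNReal.ofReal (h x) ∂μ
      ≤ ∫⁻ x, ((fun x => ENNReal.ofReal (f x) ^ (1 / p)) *
          (fun x => ENNReal.ofReal (g x) ^ (1 / q))) x ∂μ := by
        refine lintegral_mono_ae ?_
        filter_upwards [hf0, hg0, hh] with x h1 h2 h3
        rw [Pi.mul_apply, ENNReal.ofReal_rpow_of_nonneg h1 (by positivity),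
          ENNReal.ofReal_rpow_of_nonneg h2 (by positivity), ← ENNReal.ofReal_mul (by positivity)]
        exact ENNReal.ofReal_le_ofReal h3
    _ ≤ _ := ENNReal.lintegral_mul_le_Lp_mul_Lq μ hpq
        (hf.ennreal_ofReal.pow_const _) (hg.ennreal_ofReal.pow_const _)
    _ = _ := by
        simp only [← ENNReal.rpow_mul, one_div_mul_cancel hp.ne', one_div_mul_cancel hq.ne',
          ENNReal.rpow_one]

/-- The norm of the spatial gradient of a jointly measurable function is a.e. measurable where
the function is differentiable in space. -/
theorem aemeasurable_norm_gradient {ι Y : Type*} [Fintype ι] [MeasurableSpace Y]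
    {u : Y → EuclideanSpace ℝ ι → ℝ} (hu : Measurable (Function.uncurry u))
    {μ : Measure (Y × EuclideanSpace ℝ ι)}
    (hd : ∀ᵐ z ∂μ, DifferentiableAt ℝ (u z.1) z.2) :
    AEMeasurable (fun z : Y × EuclideanSpace ℝ ι => ‖gradient (u z.1) z.2‖) μ := by
  classical
  have hcoord (i : ι) :
      AEMeasurable (fun z : Y × EuclideanSpace ℝ ι => gradient (u z.1) z.2 i) μ := by
    refine aemeasurable_of_tendsto_metrizable_ae Filter.atTop
      (f := fun (k : ℕ) z => (k : ℝ) • (u z.1 (z.2 + (k : ℝ)⁻¹ • EuclideanSpace.single i 1)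
        - u z.1 z.2)) (fun k => ?_) ?_
    · have h1 : Measurable fun z : Y × EuclideanSpace ℝ ι =>
          u z.1 (z.2 + (k : ℝ)⁻¹ • EuclideanSpace.single i 1) :=
        hu.comp (measurable_fst.prodMk (measurable_snd.add_const _))
      exact ((h1.sub hu).const_smul (k : ℝ)).aemeasurable
    · filter_upwards [hd] with z hz
      have h := hz.hasGradientAt.hasFDerivAt.lim (EuclideanSpace.single i (1 : ℝ))
        (c := fun k : ℕ => (k : ℝ)) (l := Filter.atTop)
        (by simpa using tendsto_natCast_atTop_atTop (R := ℝ))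
      rw [InnerProductSpace.toDual_apply_apply, EuclideanSpace.inner_single_right] at h
      simpa using h
  simp_rw [EuclideanSpace.norm_eq]
  exact (Finset.aemeasurable_fun_sum _ fun i _ => (hcoord i).norm.pow_const 2).sqrt

theorem one_add_rpow_le_two_rpow_mul {x r : ℝ} (hx : 0 ≤ x) (hr : 0 ≤ r) :
    (1 + x) ^ r ≤ 2 ^ r * (1 + x ^ r) := by
  rcases le_total x 1 with h | h
  · calc (1 + x) ^ r ≤ 2 ^ r := Real.rpow_le_rpow (by positivity) (by linarith) hr
      _ ≤ _ := le_mul_of_one_le_right (by positivity) (by linarith [Real.rpow_nonneg hx r])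
  · calc (1 + x) ^ r ≤ (2 * x) ^ r := Real.rpow_le_rpow (by positivity) (by linarith) hr
      _ = 2 ^ r * x ^ r := Real.mul_rpow (by norm_num) hx
      _ ≤ _ := by gcongr; linarith

/-- Factorization of the integrand of the first application of Hölder's inequality. -/
theorem rpow_mul_mul_sq_eq {v g w c a b k m r : ℝ} (hv : 0 ≤ v) (hg : 0 ≤ g) (hw : 0 < w)
    (hc : 0 ≤ c) (ha : a < 1) (hb : 0 < b) (hm : 0 < m)
    (hk : k * (2 - a) = b + m * (1 - a)) :
    v ^ k * g * c ^ 2 =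
      (v ^ b / (1 + v) ^ r * g ^ (2 - a) * w * c ^ 2) ^ (1 / (2 - a)) *
      (v ^ m * (1 + v) ^ (r / (1 - a)) * w ^ (-(1 / (1 - a))) * c ^ 2) ^
        (1 / ((2 - a) / (1 - a))) := by
  have hp : 0 < 2 - a := by linarith
  have hs : 0 < 1 - a := by linarith
  have hk0 : 0 < k := by
    by_contra! h
    nlinarith [mul_pos hm hs]
  rcases hv.eq_or_lt with rfl | hv
  · simp [Real.zero_rpow hk0.ne', Real.zero_rpow hb.ne', Real.zero_rpow hm.ne',
      Real.zero_rpow (inv_pos.2 hp).ne']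
  rcases hg.eq_or_lt with rfl | hg
  · simp [Real.zero_rpow hp.ne', Real.zero_rpow (inv_pos.2 hp).ne']
  rcases hc.eq_or_lt with rfl | hc
  · simp [Real.zero_rpow (inv_pos.2 hp).ne']
  have h1 : 0 < 1 + v := by linarith
  have hk' : k = (b + m * (1 - a)) / (2 - a) := by field_simp; linarith
  apply Real.log_injOn_pos (Set.mem_Ioi.2 (by positivity)) (Set.mem_Ioi.2 (by positivity))
  have e1 : Real.log (v ^ k * g * c ^ 2) = k * Real.log v + Real.log g + 2 * Real.log c := by
    rw [Real.log_mul (by positivity) (by positivity), Real.log_mul (by positivity) (by positivity),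
      Real.log_rpow hv, Real.log_pow]
    norm_num
  rw [e1, Real.log_mul (by positivity) (by positivity), Real.log_rpow (by positivity),
    Real.log_rpow (by positivity)]
  rw [Real.log_mul (by positivity) (by positivity), Real.log_mul (by positivity) (by positivity),
    Real.log_mul (by positivity) (by positivity), Real.log_div (by positivity) (by positivity),
    Real.log_mul (by positivity) (by positivity), Real.log_mul (by positivity) (by positivity),
    Real.log_mul (by positivity) (by positivity)]
  simp only [Real.log_rpow hv, Real.log_rpow h1, Real.log_rpow hg, Real.log_rpow hw, Real.log_pow]
  rw [hk']
  push_cast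
  field_simp
  ring

/-- Pointwise bound of the integrand of the second application of Hölder's inequality. -/
theorem rpow_mul_rpow_neg_mul_sq_le {v w f c p q s m : ℝ} (hpq : p.HolderConjugate q)
    (hv : 0 ≤ v) (hw : 0 < w) (hf : 0 < f) (hc : c ∈ Set.Icc (0 : ℝ) 1) :
    v ^ m * w ^ (-(1 / s)) * c ^ 2 ≤
      (f * v ^ (p * m) * c) ^ (1 / p) * (w ^ (-(q / s)) * f ^ (-(q / p)) * c ^ 2) ^ (1 / q) := by
  obtain ⟨hc0, hc1⟩ := hc
  have hp := hpq.pos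
  have hq := hpq.symm.pos
  have ev : (v ^ (p * m)) ^ (1 / p) = v ^ m := by
    rw [← Real.rpow_mul hv]; congr 1; field_simp
  have ew : (w ^ (-(q / s))) ^ (1 / q) = w ^ (-(1 / s)) := by
    rw [← Real.rpow_mul hw.le]; congr 1; field_simp
  have ef : f ^ (1 / p) * (f ^ (-(q / p))) ^ (1 / q) = 1 := by
    rw [← Real.rpow_mul hf.le, ← Real.rpow_add hf,
      show 1 / p + -(q / p) * (1 / q) = 0 by field_simp; ring, Real.rpow_zero]
  have ec : c ^ 2 ≤ c ^ (1 / p) * (c ^ 2) ^ (1 / q) := by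
    have hsum : 1 / p + 1 / q = 1 := by simpa using hpq.inv_add_inv_eq_one
    calc c ^ 2 = (c ^ 2) ^ (1 / p) * (c ^ 2) ^ (1 / q) := by
          rw [← Real.rpow_add_of_nonneg (by positivity) (by positivity) (by positivity), hsum,
            Real.rpow_one]
      _ ≤ _ := by gcongr; nlinarith
  rw [Real.mul_rpow (by positivity) hc0, Real.mul_rpow hf.le (by positivity),
    Real.mul_rpow (by positivity) (by positivity), Real.mul_rpow (by positivity) (by positivity),
    ev, ew]
  calc v ^ m * w ^ (-(1 / s)) * c ^ 2
      ≤ v ^ m * w ^ (-(1 / s)) * (c ^ (1 / p) * (c ^ 2) ^ (1 / q)) := by gcongr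
    _ = v ^ m * w ^ (-(1 / s)) * (c ^ (1 / p) * (c ^ 2) ^ (1 / q)) *
          (f ^ (1 / p) * (f ^ (-(q / p))) ^ (1 / q)) := by rw [ef, mul_one]
    _ = _ := by ring

/-- The Hölder-inequality chain estimating the term `J₃` in Step 2 of the proof of
Lemma 5.1. -/
theorem stmt_10
    (n : ℕ) (hn : 2 ≤ n)
    (U : Set (EuclideanSpace ℝ (Fin n)))
    (hUo : IsOpen U) (hUne : U.Nonempty) (hUb : Bornology.IsBounded U)
    (a lam α : ℝ) (ha : a ∈ Set.Ioo (0:ℝ) 1) (hlam : 0 < lam) (hα : lam + 1 < α)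
    (p₅ q₅ : ℝ) (hp₅ : 1 < p₅) (hq₅ : q₅ = p₅ / (p₅ - 1))
    (T : ℝ) (hT : 0 < T)
    (φ W₁ : EuclideanSpace ℝ (Fin n) → ℝ)
    (hφm : Measurable φ) (hW₁m : Measurable W₁)
    (hφpos : ∀ x ∈ U, 0 < φ x) (hW₁pos : ∀ x ∈ U, 0 < W₁ x)
    (ξ : ℝ → ℝ) (hξm : Measurable ξ) (hξ : ∀ t, ξ t ∈ Set.Icc (0:ℝ) 1)
    (u : ℝ → EuclideanSpace ℝ (Fin n) → ℝ)
    (hum : Measurable (Function.uncurry u))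
    (hud : ∀ᵐ t ∂(volume.restrict (Set.Ioo (0:ℝ) T)), ContDiffOn ℝ 1 (u t) (closure U))
    (hupos : ∀ t x, 0 ≤ u t x)
    (α₃ m₄ α₅ α₆ : ℝ) (hα₃ : 0 < α₃)
    (hm₄ : m₄ = ((α₃ - 1) * (2 - a) - (α - lam - 1)) / (1 - a)) (hm₄pos : 0 < m₄)
    (hα₅ : α₅ = p₅ * m₄) (hα₆ : α₆ = p₅ * (m₄ + 2 * lam / (1 - a)))
    (A₀ F₅ : ℝ≥0∞) (Efun : ℝ → ℝ≥0∞)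
    (hA₀ : A₀ = ∫⁻ t in Set.Ioo (0:ℝ) T, ∫⁻ x in U,
      ENNReal.ofReal (u t x ^ (α - lam - 1) / (1 + u t x) ^ (2 * lam) *
        ‖gradient (u t) x‖ ^ (2 - a) * W₁ x * ξ t ^ 2))
    (hF₅ : F₅ = (∫⁻ t in Set.Ioo (0:ℝ) T, ∫⁻ x in U,
      ENNReal.ofReal (W₁ x ^ (-(q₅ / (1 - a))) * φ x ^ (-(q₅ / p₅)) * ξ t ^ 2)) ^ (1 / q₅))
    (hEfun : ∀ β : ℝ, Efun β = ∫⁻ t in Set.Ioo (0:ℝ) T, ∫⁻ x in U,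
      ENNReal.ofReal (φ x * u t x ^ β * ξ t)) :
    (∫⁻ t in Set.Ioo (0:ℝ) T, ∫⁻ x in U,
        ENNReal.ofReal (u t x ^ (α₃ - 1) * ‖gradient (u t) x‖ * ξ t ^ 2)) ≤
      ENNReal.ofReal ((2:ℝ) ^ (2 * lam / (2 - a))) * A₀ ^ (1 / (2 - a)) *
        F₅ ^ ((1 - a) / (2 - a)) *
        (Efun α₅ ^ (1 / p₅) + Efun α₆ ^ (1 / p₅)) ^ ((1 - a) / (2 - a)) := by
  obtain ⟨ha0, ha1⟩ := ha
  have hs : 0 < 1 - a := by linarith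
  have hp : 0 < 2 - a := by linarith
  have hpq : (2 - a).HolderConjugate ((2 - a) / (1 - a)) := by
    rw [Real.holderConjugate_iff]
    refine ⟨by linarith, ?_⟩
    field_simp
    ring
  have hpq₅ : p₅.HolderConjugate q₅ := hq₅ ▸ Real.HolderConjugate.conjExponent hp₅
  let μ : Measure (ℝ × EuclideanSpace ℝ (Fin n)) :=
    (volume.restrict (Set.Ioo 0 T)).prod (volume.restrict U)
  have hU : ∀ᵐ z ∂μ, z.2 ∈ U :=
    Measure.quasiMeasurePreserving_snd.ae (ae_restrict_mem hUo.measurableSet)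
  have hG : AEMeasurable (fun z => ‖gradient (u z.1) z.2‖) μ := by
    refine aemeasurable_norm_gradient hum ?_
    filter_upwards [hU, Measure.quasiMeasurePreserving_fst.ae hud] with z hz hzd
    exact (hzd.differentiableOn one_ne_zero).differentiableAt
      (Filter.mem_of_superset (hUo.mem_nhds hz) subset_closure)
  have hu' : Measurable fun z : ℝ × EuclideanSpace ℝ (Fin n) => u z.1 z.2 := hum
  have hW' : Measurable fun z : ℝ × EuclideanSpace ℝ (Fin n) => W₁ z.2 := hW₁m.comp measurable_snd
  have hφ' : Measurable fun z : ℝ × EuclideanSpace ℝ (Fin n) => φ z.2 := hφm.comp measurable_snd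
  have hξ' : Measurable fun z : ℝ × EuclideanSpace ℝ (Fin n) => ξ z.1 := hξm.comp measurable_fst
  have hiter {f : ℝ → EuclideanSpace ℝ (Fin n) → ℝ}
      (hf : AEMeasurable (fun z : ℝ × EuclideanSpace ℝ (Fin n) => f z.1 z.2) μ) :
      ∫⁻ t in Set.Ioo 0 T, ∫⁻ x in U, ENNReal.ofReal (f t x) =
        ∫⁻ z, ENNReal.ofReal (f z.1 z.2) ∂μ :=
    (lintegral_prod (fun z : ℝ × EuclideanSpace ℝ (Fin n) => ENNReal.ofReal (f z.1 z.2))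
      hf.ennreal_ofReal).symm
  have hAm : AEMeasurable (fun z : ℝ × EuclideanSpace ℝ (Fin n) =>
      u z.1 z.2 ^ (α - lam - 1) / (1 + u z.1 z.2) ^ (2 * lam) *
        ‖gradient (u z.1) z.2‖ ^ (2 - a) * W₁ z.2 * ξ z.1 ^ 2) μ := by fun_prop
  have hFm : Measurable (fun z : ℝ × EuclideanSpace ℝ (Fin n) =>
      W₁ z.2 ^ (-(q₅ / (1 - a))) * φ z.2 ^ (-(q₅ / p₅)) * ξ z.1 ^ 2) := by fun_prop
  have hEm (β : ℝ) : Measurable (fun z : ℝ × EuclideanSpace ℝ (Fin n) =>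
      φ z.2 * u z.1 z.2 ^ β * ξ z.1) := by fun_prop
  have hBm : Measurable (fun z : ℝ × EuclideanSpace ℝ (Fin n) =>
      u z.1 z.2 ^ m₄ * (1 + u z.1 z.2) ^ (2 * lam / (1 - a)) * W₁ z.2 ^ (-(1 / (1 - a))) *
        ξ z.1 ^ 2) := by fun_prop
  rw [hiter (f := fun t x => u t x ^ (α₃ - 1) * ‖gradient (u t) x‖ * ξ t ^ 2) (by fun_prop)]
  rw [hiter hAm] at hA₀
  rw [hiter (f := fun t x => W₁ x ^ (-(q₅ / (1 - a))) * φ x ^ (-(q₅ / p₅)) * ξ t ^ 2)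
    hFm.aemeasurable] at hF₅
  have hE (β : ℝ) : Efun β = ∫⁻ z, ENNReal.ofReal (φ z.2 * u z.1 z.2 ^ β * ξ z.1) ∂μ := by
    rw [hEfun, hiter (f := fun t x => φ x * u t x ^ β * ξ t) (hEm β).aemeasurable]
  have hHolder₁ := lintegral_ofReal_le_of_le_rpow_mul_rpow (μ := μ) hpq hAm hBm.aemeasurable
    (h := fun z => u z.1 z.2 ^ (α₃ - 1) * ‖gradient (u z.1) z.2‖ * ξ z.1 ^ 2)
    (by
      filter_upwards [hU] with z hz
      have := hupos z.1 z.2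
      have := hW₁pos _ hz
      positivity)
    (by
      filter_upwards [hU] with z hz
      have := hupos z.1 z.2
      have := hW₁pos _ hz
      positivity)
    (by
      filter_upwards [hU] with z hz
      refine (rpow_mul_mul_sq_eq (hupos _ _) (norm_nonneg _) (hW₁pos _ hz) (hξ _).1 ha1
        (by linarith) hm₄pos ?_).le
      rw [hm₄]
      field_simp
      ring)
  have hHolder₂ (m : ℝ) :
      ∫⁻ z, ENNReal.ofReal (u z.1 z.2 ^ m * W₁ z.2 ^ (-(1 / (1 - a))) * ξ z.1 ^ 2) ∂μ ≤
        Efun (p₅ * m) ^ (1 / p₅) * F₅ := by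
    rw [hE, hF₅]
    refine lintegral_ofReal_le_of_le_rpow_mul_rpow hpq₅ (hEm _).aemeasurable hFm.aemeasurable
      ?_ ?_ ?_
    · filter_upwards [hU] with z hz
      have := hupos z.1 z.2
      have := hφpos _ hz
      have := (hξ z.1).1
      positivity
    · filter_upwards [hU] with z hz
      have := hW₁pos _ hz
      have := hφpos _ hz
      positivity
    · filter_upwards [hU] with z hz
      exact rpow_mul_rpow_neg_mul_sq_le hpq₅ (hupos _ _) (hW₁pos _ hz) (hφpos _ hz) (hξ _)
  have hB : ∫⁻ z, ENNReal.ofReal (u z.1 z.2 ^ m₄ * (1 + u z.1 z.2) ^ (2 * lam / (1 - a)) *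
        W₁ z.2 ^ (-(1 / (1 - a))) * ξ z.1 ^ 2) ∂μ ≤
      ENNReal.ofReal (2 ^ (2 * lam / (1 - a))) *
        (F₅ * (Efun α₅ ^ (1 / p₅) + Efun α₆ ^ (1 / p₅))) := by
    calc _ ≤ ∫⁻ z, ENNReal.ofReal (2 ^ (2 * lam / (1 - a))) *
          (ENNReal.ofReal (u z.1 z.2 ^ m₄ * W₁ z.2 ^ (-(1 / (1 - a))) * ξ z.1 ^ 2) +
            ENNReal.ofReal (u z.1 z.2 ^ (m₄ + 2 * lam / (1 - a)) * W₁ z.2 ^ (-(1 / (1 - a))) *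
              ξ z.1 ^ 2)) ∂μ := by
          refine lintegral_mono_ae ?_
          filter_upwards [hU] with z hz
          have hv := hupos z.1 z.2
          have hw := hW₁pos _ hz
          have hr : 0 ≤ 2 * lam / (1 - a) := by positivity
          rw [← ENNReal.ofReal_add (by positivity) (by positivity),
            ← ENNReal.ofReal_mul (by positivity)]
          refine ENNReal.ofReal_le_ofReal ?_
          rw [Real.rpow_add_of_nonneg hv hm₄pos.le hr]
          calc _ ≤ u z.1 z.2 ^ m₄ * (2 ^ (2 * lam / (1 - a)) *
                (1 + u z.1 z.2 ^ (2 * lam / (1 - a)))) * W₁ z.2 ^ (-(1 / (1 - a))) *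
                ξ z.1 ^ 2 := by
                gcongr
                exact one_add_rpow_le_two_rpow_mul hv hr
            _ = _ := by ring
      _ ≤ _ := by
          rw [lintegral_const_mul _ (by fun_prop), lintegral_add_left (by fun_prop), mul_add F₅,
            mul_comm F₅, mul_comm F₅, hα₅, hα₆]
          gcongr
          · exact hHolder₂ _
          · exact hHolder₂ _
  refine hHolder₁.trans ?_
  rw [← hA₀, one_div_div]
  have hθ : 0 ≤ (1 - a) / (2 - a) := by positivity
  calc _ ≤ A₀ ^ (1 / (2 - a)) * (ENNReal.ofReal (2 ^ (2 * lam / (1 - a))) *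
        (F₅ * (Efun α₅ ^ (1 / p₅) + Efun α₆ ^ (1 / p₅)))) ^ ((1 - a) / (2 - a)) := by
        gcongr
    _ = _ := by
        rw [ENNReal.mul_rpow_of_nonneg _ _ hθ, ENNReal.mul_rpow_of_nonneg _ _ hθ,
          ENNReal.ofReal_rpow_of_nonneg (by positivity) hθ, ← Real.rpow_mul (by norm_num),
          show 2 * lam / (1 - a) * ((1 - a) / (2 - a)) = 2 * lam / (2 - a) by field_simp]
        ring
end

section
/- Let (y_j)_{j≥0}, (κ_j)_{j≥0}, (r_j)_{j≥0}, (s_j)_{j≥0}, (ω_j)_{j≥0} be sequences of real numbers with y_j ≥ 0, κ_j > 0, s_j ≥ r_j > 0 and ω_j ≥ 1 for all j ≥ 0, and let A ≥ 1 satisfy y_{j+1} ≤ A^{ω_j/κ_j} (y_j^{r_j} + y_j^{s_j})^{1/κ_j} for all j ≥ 0. Set β_j = r_j/κ_j and γ_j = s_j/κ_j. Assume ᾱ := Σ_{j=0}^∞ ω_j/κ_j < ∞ and that the infinite products ∏_{j=0}^∞ β_j and ∏_{j=0}^∞ γ_j converge to positive numbers β̄ and γ̄ respectively. Then G := lim sup_{j→∞}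 G_j is a finite positive number, where G_j = max{1, γ_m γ_{m+1} ⋯ γ_n : 1 ≤ m ≤ n < j}, and lim sup_{j→∞} y_j ≤ (2A)^{G ᾱ} · max{ y₀^{β̄}, y₀^{γ̄} }. Moreover, if γ_j ≥ 1 for all j ≥ 0, then G = ∏_{j=1}^∞ γ_j. -/
open Filter

/-- `(x ^ r + x ^ s) ^ (1 / κ)` is controlled by the larger of the two powers. -/
lemma rpow_add_rpow_rpow_le {x r s κ : ℝ} (hx : 0 ≤ x) (hκ : 0 < κ) :
    (x ^ r + x ^ s) ^ (1 / κ) ≤ 2 ^ (1 / κ) * max (x ^ (r / κ)) (x ^ (s / κ)) := by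
  have h1 : 0 ≤ x ^ r := Real.rpow_nonneg hx r
  have h2 : 0 ≤ x ^ s := Real.rpow_nonneg hx s
  have hsum : x ^ r + x ^ s ≤ 2 * max (x ^ r) (x ^ s) := by
    linarith [le_max_left (x ^ r) (x ^ s), le_max_right (x ^ r) (x ^ s)]
  have hpow (t : ℝ) : (x ^ t) ^ (1 / κ) = x ^ (t / κ) := by
    rw [← Real.rpow_mul hx, mul_one_div]
  calc (x ^ r + x ^ s) ^ (1 / κ)
      ≤ (2 * max (x ^ r) (x ^ s)) ^ (1 / κ) := by gcongr
    _ = 2 ^ (1 / κ) * max (x ^ r) (x ^ s) ^ (1 / κ) :=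
        Real.mul_rpow (by norm_num) (le_max_of_le_left h1)
    _ ≤ 2 ^ (1 / κ) * max (x ^ (r / κ)) (x ^ (s / κ)) := by
        gcongr
        rcases max_choice (x ^ r) (x ^ s) with h | h <;> rw [h, hpow]
        · exact le_max_left _ _
        · exact le_max_right _ _

lemma max_rpow_mul_max_rpow_le {x K b c β γ : ℝ} (hx : 0 ≤ x) (hK : 1 ≤ K)
    (hb : 0 < b) (hbc : b ≤ c) (hβ : 0 < β) (hβγ : β ≤ γ) :
    max ((K * max (x ^ b) (x ^ c)) ^ β) ((K * max (x ^ b) (x ^ c)) ^ γ) ≤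
      K ^ γ * max (x ^ (b * β)) (x ^ (c * γ)) := by
  have hM : 0 ≤ max (x ^ b) (x ^ c) := le_max_of_le_left (Real.rpow_nonneg hx b)
  have hK0 : 0 ≤ K := zero_le_one.trans hK
  have key : max (x ^ b) (x ^ c) ^ β ≤ max (x ^ (b * β)) (x ^ (c * γ)) ∧
      max (x ^ b) (x ^ c) ^ γ ≤ max (x ^ (b * β)) (x ^ (c * γ)) := by
    rcases le_total x 1 with h | h
    · rw [max_eq_left (Real.rpow_le_rpow_of_exponent_ge_of_imp hx h hbc (by intros; linarith))]
      have h1 : (x ^ b) ^ β ≤ max (x ^ (b * β)) (x ^ (c * γ)) := by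
        rw [← Real.rpow_mul hx]
        exact le_max_left _ _
      refine ⟨h1, le_trans ?_ h1⟩
      exact Real.rpow_le_rpow_of_exponent_ge_of_imp (Real.rpow_nonneg hx b)
        (Real.rpow_le_one hx h hb.le) hβγ (by intros; linarith)
    · rw [max_eq_right (Real.rpow_le_rpow_of_exponent_le h hbc)]
      have h1 : (x ^ c) ^ γ ≤ max (x ^ (b * β)) (x ^ (c * γ)) := by
        rw [← Real.rpow_mul hx]
        exact le_max_right _ _
      refine ⟨le_trans ?_ h1, h1⟩
      exact Real.rpow_le_rpow_of_exponent_le (Real.one_le_rpow h (hb.le.trans hbc)) hβγ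
  rw [Real.mul_rpow hK0 hM, Real.mul_rpow hK0 hM]
  refine max_le ?_ ?_
  · exact mul_le_mul (Real.rpow_le_rpow_of_exponent_le hK hβγ) key.1 (by positivity) (by positivity)
  · exact mul_le_mul_of_nonneg_left key.2 (by positivity)

/-- Iterating `y (j + 1) ≤ B ^ a j * max (y j ^ β j) (y j ^ γ j)`. -/
lemma le_rpow_sum_mul_max_of_rec {y a β γ : ℕ → ℝ} {B : ℝ} (hB : 1 ≤ B)
    (hy : ∀ j, 0 ≤ y j) (ha : ∀ j, 0 ≤ a j) (hβ : ∀ j, 0 < β j) (hβγ : ∀ j, β j ≤ γ j)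
    (hrec : ∀ j, y (j + 1) ≤ B ^ a j * max (y j ^ β j) (y j ^ γ j)) (j : ℕ) :
    y j ≤ B ^ (∑ i ∈ Finset.range j, a i * ∏ k ∈ Finset.Ico (i + 1) j, γ k) *
      max (y 0 ^ ∏ i ∈ Finset.range j, β i) (y 0 ^ ∏ i ∈ Finset.range j, γ i) := by
  have hγ (j : ℕ) : 0 < γ j := (hβ j).trans_le (hβγ j)
  have hB0 : 0 < B := zero_lt_one.trans_le hB
  induction j with
  | zero => simp
  | succ j ih =>
    set e := ∑ i ∈ Finset.range j, a i * ∏ k ∈ Finset.Ico (i + 1) j, γ k with he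
    have he0 : 0 ≤ e := Finset.sum_nonneg fun i _ =>
      mul_nonneg (ha i) (Finset.prod_nonneg fun k _ => (hγ k).le)
    have hsucc : ∑ i ∈ Finset.range (j + 1), a i * ∏ k ∈ Finset.Ico (i + 1) (j + 1), γ k =
        a j + e * γ j := by
      rw [Finset.sum_range_succ, Finset.Ico_self, Finset.prod_empty, mul_one, add_comm, he,
        Finset.sum_mul]
      congr 1
      refine Finset.sum_congr rfl fun i hi => ?_
      rw [Finset.prod_Ico_succ_top (by simpa using hi), mul_assoc]
    rw [hsucc, Real.rpow_add hB0, Real.rpow_mul hB0.le, mul_assoc, Finset.prod_range_succ,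
      Finset.prod_range_succ]
    refine (hrec j).trans (mul_le_mul_of_nonneg_left ?_ (by positivity))
    refine le_trans ?_ (max_rpow_mul_max_rpow_le (hy 0) (Real.one_le_rpow hB he0)
      (Finset.prod_pos fun i _ => hβ i)
      (Finset.prod_le_prod (fun i _ => (hβ i).le) fun i _ => hβγ i) (hβ j) (hβγ j))
    exact max_le_max (Real.rpow_le_rpow (hy j) ih (hβ j).le)
      (Real.rpow_le_rpow (hy j) ih (hγ j).le)

/-- If the infinite product of a positive sequence converges to a positive number, the products
over all finite intervals are uniformly bounded. -/
lemma exists_prod_Icc_le_of_tendsto_prod {γ : ℕ → ℝ} {γbar : ℝ} (hγ : ∀ j, 0 < γ j)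
    (hγbar : 0 < γbar)
    (h : Tendsto (fun N => ∏ j ∈ Finset.range N, γ j) atTop (nhds γbar)) :
    ∃ C : ℝ, ∀ m n : ℕ, m ≤ n → ∏ i ∈ Finset.Icc m n, γ i ≤ C := by
  obtain ⟨C, hC⟩ := h.bddAbove_range
  obtain ⟨D, hD⟩ := (h.inv₀ hγbar.ne').bddAbove_range
  have hpos (N : ℕ) : 0 < ∏ j ∈ Finset.range N, γ j := Finset.prod_pos fun i _ => hγ i
  have hC' (N : ℕ) : ∏ j ∈ Finset.range N, γ j ≤ C := hC ⟨N, rfl⟩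
  have hD' (N : ℕ) : (∏ j ∈ Finset.range N, γ j)⁻¹ ≤ D := hD ⟨N, rfl⟩
  refine ⟨C * D, fun m n hmn => ?_⟩
  have hIcc : Finset.Icc m n = Finset.Ico m (n + 1) := by
    ext
    simp
  rw [hIcc, (eq_mul_inv_iff_mul_eq₀ (hpos m).ne').2
    ((mul_comm _ _).trans (Finset.prod_range_mul_prod_Ico γ (hmn.trans n.le_succ)))]
  exact mul_le_mul (hC' _) (hD' _) (inv_nonneg.2 (hpos _).le) ((hpos 0).le.trans (hC' 0))

/-- Lemma 5.4 ([CHK1, Lemma A.2]): the abstract Moser-iteration lemma for sequences. -/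
theorem stmt_12
    (y κ r s ω : ℕ → ℝ)
    (hy : ∀ j, 0 ≤ y j) (hκ : ∀ j, 0 < κ j)
    (hr : ∀ j, 0 < r j) (hrs : ∀ j, r j ≤ s j) (hω : ∀ j, 1 ≤ ω j)
    (A : ℝ) (hA : 1 ≤ A)
    (hrec : ∀ j, y (j + 1) ≤ A ^ (ω j / κ j) * (y j ^ r j + y j ^ s j) ^ (1 / κ j))
    (β γ : ℕ → ℝ) (hβ : ∀ j, β j = r j / κ j) (hγ : ∀ j, γ j = s j / κ j)
    (αbar : ℝ) (hαbar : HasSum (fun j => ω j / κ j) αbar)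
    (βbar γbar : ℝ) (hβbar : 0 < βbar) (hγbar : 0 < γbar)
    (hβprod : Tendsto (fun N => ∏ j ∈ Finset.range N, β j) atTop (nhds βbar))
    (hγprod : Tendsto (fun N => ∏ j ∈ Finset.range N, γ j) atTop (nhds γbar))
    (G : ℕ → ℝ)
    (hG : ∀ j, IsGreatest
      (insert (1:ℝ)
        {c : ℝ | ∃ mm nn : ℕ, 1 ≤ mm ∧ mm ≤ nn ∧ nn < j ∧ c = ∏ i ∈ Finset.Icc mm nn, γ i})
      (G j)) :
    (0 < limsup G atTop ∧ IsBoundedUnder (· ≤ ·) atTop G) ∧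
      limsup y atTop ≤
        (2 * A) ^ (limsup G atTop * αbar) * max (y 0 ^ βbar) (y 0 ^ γbar) ∧
      ((∀ j, 1 ≤ γ j) →
        Tendsto (fun N => ∏ j ∈ Finset.Icc 1 N, γ j) atTop (nhds (limsup G atTop))) := by
  have hβpos (j : ℕ) : 0 < β j := hβ j ▸ div_pos (hr j) (hκ j)
  have hβγ (j : ℕ) : β j ≤ γ j := by
    rw [hβ, hγ]
    exact div_le_div_of_nonneg_right (hrs j) (hκ j).le
  have hγpos (j : ℕ) : 0 < γ j := (hβpos j).trans_le (hβγ j)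
  have ha (j : ℕ) : 0 ≤ ω j / κ j := div_nonneg (zero_le_one.trans (hω j)) (hκ j).le
  have hA0 : 0 < 2 * A := by linarith
  have hA1 : 1 ≤ 2 * A := by linarith
  have hG1 (j : ℕ) : 1 ≤ G j := (hG j).2 (Set.mem_insert _ _)
  have hGmono : Monotone G := by
    intro i j hij
    refine (hG j).2 (Set.insert_subset_insert ?_ (hG i).1)
    rintro c ⟨m, n, hm, hmn, hn, rfl⟩
    exact ⟨m, n, hm, hmn, hn.trans_le hij, rfl⟩
  obtain ⟨C, hC⟩ := exists_prod_Icc_le_of_tendsto_prod hγpos hγbar hγprod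
  have hGbdd : BddAbove (Set.range G) := by
    refine ⟨max 1 C, ?_⟩
    rintro _ ⟨j, rfl⟩
    rcases (hG j).1 with h | ⟨m, n, -, hmn, -, h⟩ <;> rw [h]
    · exact le_max_left _ _
    · exact (hC m n hmn).trans (le_max_right _ _)
  have hGlim : Tendsto G atTop (nhds (limsup G atTop)) := by
    have h := tendsto_atTop_ciSup hGmono hGbdd
    rwa [h.limsup_eq]
  refine ⟨⟨?_, hGlim.isBoundedUnder_le⟩, ?_, fun hγ1 => ?_⟩
  · exact zero_lt_one.trans_le (ge_of_tendsto' hGlim hG1)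
  · have hstep (j : ℕ) :
        y (j + 1) ≤ (2 * A) ^ (ω j / κ j) * max (y j ^ β j) (y j ^ γ j) := by
      have hmax : 0 ≤ max (y j ^ β j) (y j ^ γ j) :=
        le_max_of_le_left (Real.rpow_nonneg (hy j) _)
      have hA' : 0 ≤ A ^ (ω j / κ j) := Real.rpow_nonneg (by linarith) _
      have h2 : (2 : ℝ) ^ (1 / κ j) ≤ 2 ^ (ω j / κ j) :=
        Real.rpow_le_rpow_of_exponent_le one_le_two
          (div_le_div_of_nonneg_right (hω j) (hκ j).le)
      calc y (j + 1) ≤ A ^ (ω j / κ j) * (y j ^ r j + y j ^ s j) ^ (1 / κ j) := hrec j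
        _ ≤ A ^ (ω j / κ j) * (2 ^ (1 / κ j) * max (y j ^ β j) (y j ^ γ j)) := by
            rw [hβ, hγ]
            exact mul_le_mul_of_nonneg_left (rpow_add_rpow_rpow_le (hy j) (hκ j)) hA'
        _ ≤ A ^ (ω j / κ j) * (2 ^ (ω j / κ j) * max (y j ^ β j) (y j ^ γ j)) := by gcongr
        _ = (2 * A) ^ (ω j / κ j) * max (y j ^ β j) (y j ^ γ j) := by
            rw [Real.mul_rpow zero_le_two (by linarith)]
            ring
    have hexp (j : ℕ) :
        ∑ i ∈ Finset.range j, ω i / κ i * ∏ k ∈ Finset.Ico (i + 1) j, γ k ≤ G j * αbar := by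
      have hprod (i : ℕ) (hi : i < j) : ∏ k ∈ Finset.Ico (i + 1) j, γ k ≤ G j := by
        rcases (Nat.succ_le_of_lt hi).eq_or_lt with h | h
        · simpa [← h] using hG1 (i + 1)
        · refine (hG j).2 (Or.inr ⟨i + 1, j - 1, by omega, by omega, by omega, ?_⟩)
          congr 1
          ext k
          simp only [Finset.mem_Ico, Finset.mem_Icc]
          omega
      calc ∑ i ∈ Finset.range j, ω i / κ i * ∏ k ∈ Finset.Ico (i + 1) j, γ k
          ≤ ∑ i ∈ Finset.range j, ω i / κ i * G j :=
            Finset.sum_le_sum fun i hi =>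
              mul_le_mul_of_nonneg_left (hprod i (Finset.mem_range.1 hi)) (ha i)
        _ = G j * ∑ i ∈ Finset.range j, ω i / κ i := by rw [← Finset.sum_mul, mul_comm]
        _ ≤ G j * αbar :=
            mul_le_mul_of_nonneg_left (sum_le_hasSum _ (fun i _ => ha i) hαbar)
              (zero_le_one.trans (hG1 j))
    have hle (j : ℕ) : y j ≤ (2 * A) ^ (G j * αbar) *
        max (y 0 ^ ∏ i ∈ Finset.range j, β i) (y 0 ^ ∏ i ∈ Finset.range j, γ i) :=
      (le_rpow_sum_mul_max_of_rec hA1 hy ha hβpos hβγ hstep j).trans <|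
        mul_le_mul_of_nonneg_right (Real.rpow_le_rpow_of_exponent_le hA1 (hexp j))
          (le_max_of_le_left (Real.rpow_nonneg (hy 0) _))
    have hlim : Tendsto (fun j => (2 * A) ^ (G j * αbar) *
        max (y 0 ^ ∏ i ∈ Finset.range j, β i) (y 0 ^ ∏ i ∈ Finset.range j, γ i)) atTop
        (nhds ((2 * A) ^ (limsup G atTop * αbar) * max (y 0 ^ βbar) (y 0 ^ γbar))) :=
      ((Real.continuousAt_const_rpow hA0.ne').tendsto.comp (hGlim.mul_const αbar)).mul
        (((Real.continuousAt_const_rpow' hβbar.ne').tendsto.comp hβprod).max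
          ((Real.continuousAt_const_rpow' hγbar.ne').tendsto.comp hγprod))
    rw [← hlim.limsup_eq]
    exact limsup_le_limsup (Eventually.of_forall hle)
      (isBoundedUnder_of ⟨0, hy⟩).isCoboundedUnder_le hlim.isBoundedUnder_le
  · refine ((tendsto_add_atTop_iff_nat 1).2 hGlim).congr fun N => le_antisymm ?_ ?_
    · rcases (hG (N + 1)).1 with h | ⟨m, n, hm, -, hn, h⟩ <;> rw [h]
      · exact Finset.one_le_prod fun i _ => hγ1 i
      · exact Finset.prod_le_prod_of_subset_of_one_le
          (Finset.Icc_subset_Icc hm (Nat.lt_succ_iff.1 hn)) (fun i _ => (hγpos i).le)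
          fun i _ _ => hγ1 i
    · rcases Nat.eq_zero_or_pos N with rfl | hN
      · simpa using hG1 1
      · exact (hG (N + 1)).2 (Or.inr ⟨1, N, le_rfl, hN, Nat.lt_succ_self N, rfl⟩)
end
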